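/- Let C be an abelian category with enough projectives. An object of finite G-dimension is Gorenstein projective if and only if it lies in ⊥pC (all positive Ext groups into projectives vanish). Equivalently, ⊥pC ∩ gpC^(−) = gpC. -/

import Mathlib

open CategoryTheory CategoryTheory.Limits

universe w w' v v' u u'

section Defs

variable {C : Type u} [Category.{v} C] [Abelian C]

/-- `f`, `g` form a short exact sequence `0 → X → Y → Z → 0`. -/
def IsSES {X Y Z : C} (f : X ⟶ Y) (g : Y ⟶ Z) : Prop :=
  ∃ w : f ≫ g = 0, (ShortComplex.mk f g w).ShortExact

/-- Vanishing of the Yoneda Ext¹ group: every short exact sequence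
`0 → P → E → Z → 0` splits. -/
def YonedaExt1Zero (Z P : C) : Prop :=
  ∀ (E : C) (i : P ⟶ E) (p : E ⟶ Z), IsSES i p → ∃ s : Z ⟶ E, s ≫ p = 𝟙 Z

/-- A totally acyclic complex of projectives: an exact complex of projective
objects which stays exact after applying `Hom(-, Q)` for every projective `Q`. -/
structure IsTotallyAcyclic (P : ChainComplex C ℤ) : Prop where
  projective : ∀ i, Projective (P.X i)
  acyclic : ∀ i, P.ExactAt i
  homExact : ∀ (Q : C), Projective Q → ∀ (i : ℤ) (f : P.X i ⟶ Q),
    P.d (i + 1) i ≫ f = 0 → ∃ g : P.X (i - 1) ⟶ Q, P.d i (i - 1) ≫ g = f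

/-- An object is Gorenstein projective if it is (isomorphic to) a syzygy of a
totally acyclic complex of projectives. -/
def IsGorensteinProjective (X : C) : Prop :=
  ∃ P : ChainComplex C ℤ, IsTotallyAcyclic P ∧ Nonempty (X ≅ cokernel (P.d 1 0))

/-- `X` admits a resolution of length at most `n` by objects satisfying `S`. -/
inductive HasResDimLE (S : C → Prop) : C → ℕ → Prop
  | of_mem {X : C} (hX : S X) (n : ℕ) : HasResDimLE S X n
  | step {X K G : C} (n : ℕ) (f : K ⟶ G) (g : G ⟶ X)
      (hses : IsSES f g) (hG : S G) (hK : HasResDimLE S K n) :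
      HasResDimLE S X (n + 1)

/-- The G-dimension: the minimal length of a Gorenstein projective resolution. -/
noncomputable def gDim (X : C) : ℕ∞ :=
  sInf {n : ℕ∞ | ∃ m : ℕ, n = (m : ℕ∞) ∧ HasResDimLE IsGorensteinProjective X m}

variable [HasExt.{w} C]

/-- The projective dimension: the minimal `m` such that `Ext^j(X, -)` vanishes
for all `j > m`. -/
noncomputable def projDim (X : C) : ℕ∞ :=
  sInf {n : ℕ∞ | ∃ m : ℕ, n = (m : ℕ∞) ∧
    ∀ (Y : C) (j : ℕ), m < j → Subsingleton (Abelian.Ext X Y j)}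

/-- The injective dimension: the minimal `m` such that `Ext^j(-, X)` vanishes
for all `j > m`. -/
noncomputable def injDim (X : C) : ℕ∞ :=
  sInf {n : ℕ∞ | ∃ m : ℕ, n = (m : ℕ∞) ∧
    ∀ (Y : C) (j : ℕ), m < j → Subsingleton (Abelian.Ext Y X j)}

end Defs

section GorensteinProjective

open scoped ZeroObject

variable {C : Type u} [Category.{v} C] [Abelian C]

section ShortExactSequences

lemma isSES_cokernel {X Y : C} (f : X ⟶ Y) [Mono f] : IsSES f (cokernel.π f) :=
  ⟨cokernel.condition f, { exact := ShortComplex.exact_cokernel f }⟩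

lemma isSES_kernel {X Y : C} (g : X ⟶ Y) [Epi g] : IsSES (kernel.ι g) g :=
  ⟨kernel.condition g, { exact := ShortComplex.exact_kernel g }⟩

lemma isSES_id_zero (X : C) : IsSES (𝟙 X) (0 : X ⟶ 0) :=
  ⟨by simp, (ShortComplex.Splitting.mk (S := ShortComplex.mk (𝟙 X) (0 : X ⟶ 0) (by simp))
    (𝟙 X) 0 (by simp) ((isZero_zero C).eq_of_src _ _) (by simp)).shortExact⟩

lemma isSES_zero_id (X : C) : IsSES (0 : 0 ⟶ X) (𝟙 X) :=
  ⟨by simp, (ShortComplex.Splitting.mk (S := ShortComplex.mk (0 : 0 ⟶ X) (𝟙 X) (by simp))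
    0 (𝟙 X) ((isZero_zero C).eq_of_src _ _) (by simp) (by simp)).shortExact⟩

lemma isSES_biprod_inl_snd (X Y : C) : IsSES (biprod.inl : X ⟶ X ⊞ Y) biprod.snd :=
  ⟨by simp, (ShortComplex.Splitting.ofHasBinaryBiproduct X Y).shortExact⟩

lemma isSES_biprod_inr_fst (X Y : C) : IsSES (biprod.inr : Y ⟶ X ⊞ Y) biprod.fst :=
  ⟨by simp, (ShortComplex.Splitting.mk
    (S := ShortComplex.mk (biprod.inr : Y ⟶ X ⊞ Y) biprod.fst (by simp))
    biprod.snd biprod.inl (by simp) (by simp) (by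
      dsimp
      rw [add_comm]
      exact biprod.total)).shortExact⟩

/-- Given a monomorphism of short exact sequences that is the outer columns of a diagram with
short exact columns, the middle column and the induced bottom row are short exact too. -/
lemma exists_isSES_of_isSES_columns {A₁ B₁ C₁ A₂ B₂ C₂ A₃ C₃ : C}
    {f₁ : A₁ ⟶ B₁} {g₁ : B₁ ⟶ C₁} (h₁ : IsSES f₁ g₁)
    {f₂ : A₂ ⟶ B₂} {g₂ : B₂ ⟶ C₂} (h₂ : IsSES f₂ g₂)
    {α : A₁ ⟶ A₂} {β : B₁ ⟶ B₂} {γ : C₁ ⟶ C₂} (hαβ : α ≫ f₂ = f₁ ≫ β) (hβγ : β ≫ g₂ = g₁ ≫ γ)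
    {a : A₂ ⟶ A₃} (hα : IsSES α a) {c : C₂ ⟶ C₃} (hγ : IsSES γ c) :
    ∃ (B₃ : C) (f₃ : A₃ ⟶ B₃) (g₃ : B₃ ⟶ C₃) (b : B₂ ⟶ B₃), IsSES f₃ g₃ ∧ IsSES β b := by
  obtain ⟨w₁, h₁⟩ := h₁
  obtain ⟨w₂, h₂⟩ := h₂
  obtain ⟨wα, hα⟩ := hα
  obtain ⟨wγ, hγ⟩ := hγ
  let φ : ShortComplex.mk f₁ g₁ w₁ ⟶ ShortComplex.mk f₂ g₂ w₂ :=
    { τ₁ := α, τ₂ := β, τ₃ := γ, comm₁₂ := hαβ, comm₂₃ := hβγ }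
  let D : ShortComplex.SnakeInput C :=
    { L₀ := kernel φ
      L₁ := ShortComplex.mk f₁ g₁ w₁
      L₂ := ShortComplex.mk f₂ g₂ w₂
      L₃ := cokernel φ
      v₀₁ := kernel.ι φ
      v₁₂ := φ
      v₂₃ := cokernel.π φ
      w₀₂ := kernel.condition φ
      w₁₃ := cokernel.condition φ
      h₀ := kernelIsKernel φ
      h₃ := cokernelIsCokernel φ
      L₁_exact := h₁.exact
      epi_L₁_g := h₁.epi_g
      L₂_exact := h₂.exact
      mono_L₂_f := h₂.mono_f }
  have hmα : Mono α := hα.mono_f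
  have hmγ : Mono γ := hγ.mono_f
  have : Mono f₁ := h₁.mono_f
  have : Mono f₂ := h₂.mono_f
  have : Epi g₂ := h₂.epi_g
  have : Epi a := hα.epi_g
  have : Epi c := hγ.epi_g
  have hmβ : Mono β := by
    refine Preadditive.mono_of_cancel_zero _ fun {T} x hx => ?_
    have hxg : x ≫ g₁ = 0 := by
      rw [← cancel_mono γ, Category.assoc, ← hβγ, reassoc_of% hx, zero_comp, zero_comp]
    obtain ⟨y, rfl⟩ : ∃ y, y ≫ f₁ = x := ⟨h₁.exact.lift x hxg, h₁.exact.lift_f x hxg⟩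
    have hy : y ≫ α = 0 := by
      rw [← cancel_mono f₂, Category.assoc, hαβ, zero_comp, ← Category.assoc, hx]
    have : y = 0 := by rw [← cancel_mono α, hy, zero_comp]
    rw [this, zero_comp]
  have hz : IsZero D.L₀.X₃ := by
    rw [IsZero.iff_id_eq_zero, ← @cancel_mono _ _ _ _ _ D.v₀₁.τ₃ D.mono_v₀₁_τ₃]
    have : D.v₀₁.τ₃ ≫ γ = 0 := D.w₀₂_τ₃
    have : D.v₀₁.τ₃ = 0 := by rw [← cancel_mono γ, this, zero_comp]
    simp [this]
  have hmono : Mono D.L₃.f := D.L₂'_exact.mono_g (hz.eq_of_src _ _)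
  have : Epi D.L₂.g := h₂.epi_g
  have hepi : Epi D.L₃.g := D.epi_L₃_g
  let e₁ : A₃ ≅ D.L₃.X₁ := hα.exact.gIsCokernel.coconePointUniqueUpToIso D.h₃τ₁
  let e₃ : D.L₃.X₃ ≅ C₃ := D.h₃τ₃.coconePointUniqueUpToIso hγ.exact.gIsCokernel
  refine ⟨D.L₃.X₂, e₁.hom ≫ D.L₃.f, D.L₃.g ≫ e₃.hom, D.v₂₃.τ₂, ⟨by simp, ?_⟩,
    D.w₁₃_τ₂, ?_⟩
  · exact ShortComplex.shortExact_of_iso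
      (ShortComplex.isoMk e₁.symm (Iso.refl _) e₃ (by simp) (by simp))
      (ShortComplex.ShortExact.mk D.L₃_exact)
  · exact { exact := D.exact_C₂_down, mono_f := hmβ, epi_g := D.epi_v₂₃_τ₂ }

end ShortExactSequences

section Ext

variable [HasExt.{w} C]

/-- The objects all of whose positive `Ext` groups into projective objects vanish. -/
def IsExtPerpProjective (X : C) : Prop :=
  ∀ P : C, Projective P → ∀ n : ℕ, Subsingleton (Abelian.Ext.{w} X P (n + 1))

lemma isExtPerpProjective_of_projective (P : C) [Projective P] :
    IsExtPerpProjective.{w} P :=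
  fun Q _ n => Abelian.Ext.subsingleton_of_projective P Q n

lemma IsSES.isExtPerpProjective_middle {X Y Z : C} {f : X ⟶ Y} {g : Y ⟶ Z} (h : IsSES f g)
    (hX : IsExtPerpProjective.{w} X) (hZ : IsExtPerpProjective.{w} Z) :
    IsExtPerpProjective.{w} Y := by
  obtain ⟨_, h⟩ := h
  intro P hP n
  have := hX P hP n
  have := hZ P hP n
  refine subsingleton_of_forall_eq 0 fun x => ?_
  obtain ⟨y, rfl⟩ := Abelian.Ext.contravariant_sequence_exact₂ h P x (Subsingleton.elim _ _)
  rw [Subsingleton.elim y 0, Abelian.Ext.comp_zero]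

lemma IsSES.isExtPerpProjective_left {X Y Z : C} {f : X ⟶ Y} {g : Y ⟶ Z} (h : IsSES f g)
    (hY : IsExtPerpProjective.{w} Y) (hZ : IsExtPerpProjective.{w} Z) :
    IsExtPerpProjective.{w} X := by
  obtain ⟨_, h⟩ := h
  intro P hP n
  have := hY P hP n
  have := hZ P hP (n + 1)
  refine subsingleton_of_forall_eq 0 fun x => ?_
  obtain ⟨y, rfl⟩ := Abelian.Ext.contravariant_sequence_exact₁ h P x (add_comm 1 (n + 1))
    (Subsingleton.elim _ _)
  rw [Subsingleton.elim y 0, Abelian.Ext.comp_zero]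

lemma IsSES.exists_extension {X Y Z Q : C} {f : X ⟶ Y} {g : Y ⟶ Z} (h : IsSES f g)
    [Subsingleton (Abelian.Ext.{w} Z Q 1)] (φ : X ⟶ Q) : ∃ ψ : Y ⟶ Q, f ≫ ψ = φ := by
  obtain ⟨_, h⟩ := h
  obtain ⟨y, hy⟩ := Abelian.Ext.contravariant_sequence_exact₁ h Q (Abelian.Ext.mk₀ φ) (add_zero 1)
    (Subsingleton.elim _ _)
  obtain ⟨ψ, rfl⟩ := (Abelian.Ext.mk₀_bijective _ _).2 y
  refine ⟨ψ, (Abelian.Ext.mk₀_bijective _ _).1 ?_⟩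
  rw [← hy, Abelian.Ext.mk₀_comp_mk₀]

lemma IsSES.subsingleton_ext_one {X Y Z Q : C} {f : X ⟶ Y} {g : Y ⟶ Z} (h : IsSES f g)
    [Projective Y] (hφ : ∀ φ : X ⟶ Q, ∃ ψ : Y ⟶ Q, f ≫ ψ = φ) :
    Subsingleton (Abelian.Ext.{w} Z Q 1) := by
  obtain ⟨_, h⟩ := h
  refine subsingleton_of_forall_eq 0 fun x => ?_
  obtain ⟨y, rfl⟩ := Abelian.Ext.contravariant_sequence_exact₃ h Q x
    (Abelian.Ext.eq_zero_of_projective _) (add_zero 1)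
  obtain ⟨φ, rfl⟩ := (Abelian.Ext.mk₀_bijective _ _).2 y
  obtain ⟨ψ, rfl⟩ := hφ φ
  dsimp
  rw [← Abelian.Ext.mk₀_comp_mk₀]
  exact h.extClass_comp_assoc _

lemma IsSES.subsingleton_ext_succ {X Y Z Q : C} {f : X ⟶ Y} {g : Y ⟶ Z} (h : IsSES f g)
    [Projective Y] (n : ℕ) [Subsingleton (Abelian.Ext.{w} X Q n)] :
    Subsingleton (Abelian.Ext.{w} Z Q (n + 1)) := by
  obtain ⟨_, h⟩ := h
  refine subsingleton_of_forall_eq 0 fun x => ?_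
  obtain ⟨y, rfl⟩ := Abelian.Ext.contravariant_sequence_exact₃ h Q x
    (Abelian.Ext.eq_zero_of_projective _) (add_comm 1 n)
  rw [Subsingleton.elim y 0, Abelian.Ext.comp_zero]

end Ext

section Coresolutions

variable [HasExt.{w} C]

/-- A class of objects of `⊥pC` each of which embeds into a projective object with cokernel in
the class. -/
def IsProjectivelyCoresolving (S : C → Prop) : Prop :=
  ∀ X, S X → IsExtPerpProjective.{w} X ∧
    ∃ (P Y : C) (f : X ⟶ P) (g : P ⟶ Y), Projective P ∧ IsSES f g ∧ S Y

/-- The largest class of objects that is `IsProjectivelyCoresolving`. -/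
def HasPerpCoresolution (X : C) : Prop :=
  ∃ S : C → Prop, IsProjectivelyCoresolving.{w} S ∧ S X

lemma isProjectivelyCoresolving_hasPerpCoresolution :
    IsProjectivelyCoresolving.{w} (HasPerpCoresolution.{w} (C := C)) := by
  rintro X ⟨S, hS, hX⟩
  obtain ⟨h, P, Y, f, g, hP, hfg, hY⟩ := hS X hX
  exact ⟨h, P, Y, f, g, hP, hfg, S, hS, hY⟩

lemma HasPerpCoresolution.isExtPerpProjective {X : C} (hX : HasPerpCoresolution.{w} X) :
    IsExtPerpProjective.{w} X :=
  (isProjectivelyCoresolving_hasPerpCoresolution X hX).1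

lemma hasPerpCoresolution_of_projective (P : C) (hP : Projective P) :
    HasPerpCoresolution.{w} P :=
  ⟨Projective, fun Q _ => ⟨isExtPerpProjective_of_projective Q, Q, 0, 𝟙 Q, 0, inferInstance,
    isSES_id_zero Q, inferInstance⟩, hP⟩

lemma IsSES.hasPerpCoresolution_left {X P Y : C} {f : X ⟶ P} {g : P ⟶ Y} (h : IsSES f g)
    [hP : Projective P] (hY : HasPerpCoresolution.{w} Y) : HasPerpCoresolution.{w} X := by
  refine ⟨fun X => ∃ (P Y : C) (f : X ⟶ P) (g : P ⟶ Y), Projective P ∧ IsSES f g ∧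
    HasPerpCoresolution.{w} Y, ?_, P, Y, f, g, hP, h, hY⟩
  rintro X ⟨P, Y, f, g, hP, h, hY⟩
  exact ⟨h.isExtPerpProjective_left (isExtPerpProjective_of_projective P) hY.isExtPerpProjective,
    P, Y, f, g, hP, h, (isProjectivelyCoresolving_hasPerpCoresolution Y hY).2⟩

lemma IsSES.hasPerpCoresolution_middle {X Y Z : C} {f : X ⟶ Y} {g : Y ⟶ Z} (h : IsSES f g)
    (hX : HasPerpCoresolution.{w} X) (hZ : HasPerpCoresolution.{w} Z) :
    HasPerpCoresolution.{w} Y := by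
  refine ⟨fun Y => ∃ (X Z : C) (f : X ⟶ Y) (g : Y ⟶ Z), IsSES f g ∧
    HasPerpCoresolution.{w} X ∧ HasPerpCoresolution.{w} Z, ?_, X, Z, f, g, h, hX, hZ⟩
  rintro Y ⟨X, Z, f, g, h, hX, hZ⟩
  obtain ⟨hX', P, X', i, p, hP, hip, hcX⟩ := isProjectivelyCoresolving_hasPerpCoresolution X hX
  obtain ⟨hZ', Q, Z', j, q, hQ, hjq, hcZ⟩ := isProjectivelyCoresolving_hasPerpCoresolution Z hZ
  refine ⟨h.isExtPerpProjective_middle hX' hZ', ?_⟩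
  have := hZ' P hP 0
  obtain ⟨ψ, hψ⟩ := h.exists_extension i
  have hw := h.1
  obtain ⟨Y', f', g', b, h', hb⟩ := exists_isSES_of_isSES_columns h (isSES_biprod_inl_snd P Q)
    (β := biprod.lift ψ (g ≫ j)) (by ext <;> simp [hψ, reassoc_of% hw]) (by simp) hip hjq
  exact ⟨P ⊞ Q, Y', _, b, inferInstance, hb, X', Z', f', g', h', hcX, hcZ⟩

lemma IsSES.hasPerpCoresolution_left_of_projective {X E P : C} {f : X ⟶ E} {g : E ⟶ P}
    (h : IsSES f g) (hE : HasPerpCoresolution.{w} E) (hP : Projective P) :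
    HasPerpCoresolution.{w} X := by
  obtain ⟨-, Q, E', e, q, hQ, heq, hE'⟩ := isProjectivelyCoresolving_hasPerpCoresolution E hE
  obtain ⟨Y, f', g', b, h', hb⟩ := exists_isSES_of_isSES_columns (isSES_id_zero X) heq
    (β := f ≫ e) (by simp) (by simp [heq.1]) h (isSES_zero_id E')
  exact hb.hasPerpCoresolution_left
    (h'.hasPerpCoresolution_middle (hasPerpCoresolution_of_projective P hP) hE')

lemma IsSES.hasPerpCoresolution_right {K G X : C} {f : K ⟶ G} {g : G ⟶ X} (h : IsSES f g)
    (hK : HasPerpCoresolution.{w} K) (hG : HasPerpCoresolution.{w} G)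
    (hX : IsExtPerpProjective.{w} X) : HasPerpCoresolution.{w} X := by
  obtain ⟨-, P, K', i, p, hP, hip, hK'⟩ := isProjectivelyCoresolving_hasPerpCoresolution K hK
  have := hX P hP 0
  obtain ⟨ψ, hψ⟩ := h.exists_extension i
  obtain ⟨E, f', g', b, h', hb⟩ := exists_isSES_of_isSES_columns h (isSES_biprod_inl_snd P X)
    (β := biprod.lift ψ g) (γ := 𝟙 X) (by ext <;> simp [hψ, h.1]) (by simp) hip (isSES_id_zero X)
  have hE : HasPerpCoresolution.{w} E :=
    h'.hasPerpCoresolution_middle hK' (hasPerpCoresolution_of_projective 0 Projective.zero_projective)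
  exact (isSES_biprod_inr_fst P X).hasPerpCoresolution_left_of_projective
    (hb.hasPerpCoresolution_middle hG hE) hP

end Coresolutions

section TotallyAcyclic

lemma IsTotallyAcyclic.isSES_syzygy {P : ChainComplex C ℤ} (hP : IsTotallyAcyclic P) (i : ℤ) :
    IsSES (cokernel.desc (P.d (i + 1 + 1) (i + 1)) (P.d (i + 1) i) (by simp))
      (cokernel.π (P.d (i + 1) i)) := by
  have hex : (ShortComplex.mk (P.d (i + 1 + 1) (i + 1)) (P.d (i + 1) i) (by simp)).Exact :=
    (P.exactAt_iff' (i + 1 + 1) (i + 1) i (by simp) (by simp)).1 (hP.acyclic (i + 1))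
  have hm := hex.mono_cokernelDesc
  refine ⟨by rw [← cancel_epi (cokernel.π _)]; simp, ?_⟩
  refine { exact := ?_, mono_f := hm }
  refine (ShortComplex.exact_iff_of_epi_of_isIso_of_mono
    (S₁ := ShortComplex.mk (P.d (i + 1) i) (cokernel.π (P.d (i + 1) i)) (by simp))
    (S₂ := ShortComplex.mk (cokernel.desc (P.d (i + 1 + 1) (i + 1)) (P.d (i + 1) i) (by simp))
      (cokernel.π (P.d (i + 1) i)) (by rw [← cancel_epi (cokernel.π _)]; simp))
    { τ₁ := cokernel.π (P.d (i + 1 + 1) (i + 1)), τ₂ := 𝟙 _, τ₃ := 𝟙 _ }).1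
    (ShortComplex.exact_cokernel _)

lemma IsTotallyAcyclic.exists_extension {P : ChainComplex C ℤ} (hP : IsTotallyAcyclic P)
    {Q : C} (hQ : Projective Q) (i : ℤ) (f : P.X (i + 1) ⟶ Q)
    (hf : P.d (i + 1 + 1) (i + 1) ≫ f = 0) :
    ∃ g : P.X i ⟶ Q, P.d (i + 1) i ≫ g = f := by
  have H : ∀ j k : ℤ, j - 1 = k → ∀ f : P.X j ⟶ Q, P.d (j + 1) j ≫ f = 0 →
      ∃ g : P.X k ⟶ Q, P.d j k ≫ g = f := by
    rintro j _ rfl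
    exact hP.homExact Q hQ j
  exact H (i + 1) i (by simp) f hf

variable [HasExt.{w} C]

lemma IsTotallyAcyclic.isExtPerpProjective_syzygy {P : ChainComplex C ℤ}
    (hP : IsTotallyAcyclic P) (i : ℤ) :
    IsExtPerpProjective.{w} (cokernel (P.d (i + 1) i)) := by
  intro Q hQ n
  induction n generalizing i with
  | zero =>
    have := hP.projective i
    refine (hP.isSES_syzygy i).subsingleton_ext_one fun φ => ?_
    obtain ⟨g, hg⟩ := hP.exists_extension hQ i (cokernel.π _ ≫ φ) (by simp)
    refine ⟨g, ?_⟩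
    rw [← cancel_epi (cokernel.π _), ← hg, cokernel.π_desc_assoc]
  | succ n ih =>
    have := hP.projective i
    have := ih (i + 1)
    exact (hP.isSES_syzygy i).subsingleton_ext_succ (n + 1)

lemma IsTotallyAcyclic.hasPerpCoresolution_syzygy {P : ChainComplex C ℤ}
    (hP : IsTotallyAcyclic P) (i : ℤ) :
    HasPerpCoresolution.{w} (cokernel (P.d (i + 1) i)) := by
  refine ⟨fun X => ∃ (i : ℤ), X = cokernel (P.d (i + 1) i), ?_, i, rfl⟩
  rintro _ ⟨i, rfl⟩
  refine ⟨hP.isExtPerpProjective_syzygy i, ?_⟩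
  obtain ⟨j, rfl⟩ : ∃ j, i = j + 1 := ⟨i - 1, by simp⟩
  exact ⟨P.X j, _, _, _, hP.projective j, hP.isSES_syzygy j, j, rfl⟩

lemma IsGorensteinProjective.hasPerpCoresolution {X : C} (hX : IsGorensteinProjective X) :
    HasPerpCoresolution.{w} X := by
  obtain ⟨P, hP, ⟨e⟩⟩ := hX
  obtain ⟨-, Q, Y, f, g, hQ, ⟨hw, h⟩, hY⟩ := isProjectivelyCoresolving_hasPerpCoresolution _
    (hP.hasPerpCoresolution_syzygy.{w} 0)
  let e' : X ≅ cokernel (P.d (0 + 1) 0) := e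
  refine IsSES.hasPerpCoresolution_left (f := e'.hom ≫ f) (g := g) ⟨by simp [hw], ?_⟩ hY
  exact ShortComplex.shortExact_of_iso (S₁ := ShortComplex.mk f g hw)
    (S₂ := ShortComplex.mk (e'.hom ≫ f) g (by simp [hw]))
    (ShortComplex.isoMk e'.symm (Iso.refl _) (Iso.refl _) (by simp) (by simp)) h

/-- Short exact sequences `0 → Z (i + 1) → P i → Z i → 0`, for `i : ℤ`, with `P i` projective and
`Z i` in `⊥pC` splice into a totally acyclic complex. -/
lemma isGorensteinProjective_of_isSES (Z P : ℤ → C) (hZ : ∀ i, IsExtPerpProjective.{w} (Z i))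
    (hP : ∀ i, Projective (P i)) (f : ∀ i, Z (i + 1) ⟶ P i) (g : ∀ i, P i ⟶ Z i)
    (h : ∀ i, IsSES (f i) (g i)) : IsGorensteinProjective (Z 0) := by
  have hfg i : f i ≫ g i = 0 := (h i).1
  have hf i : Mono (f i) := (h i).2.mono_f
  have hg i : Epi (g i) := (h i).2.epi_g
  let K : ChainComplex C ℤ := ChainComplex.of P (fun i => g (i + 1) ≫ f i)
    (fun i => by simp [reassoc_of% hfg])
  have hK i : K.d (i + 1) i = g (i + 1) ≫ f i :=
    ChainComplex.of_d P (fun i => g (i + 1) ≫ f i) i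
  refine ⟨K, ⟨hP, fun i => ?_, fun Q hQ i φ hφ => ?_⟩, ⟨?_⟩⟩
  · obtain ⟨i, rfl⟩ : ∃ j, i = j + 1 := ⟨i - 1, by simp⟩
    rw [K.exactAt_iff' (i + 1 + 1) (i + 1) i (by simp) (by simp)]
    let S := ShortComplex.mk (f (i + 1)) (g (i + 1) ≫ f i) (by simp [reassoc_of% hfg])
    have hS : S.Exact := (ShortComplex.exact_iff_of_epi_of_isIso_of_mono
      (S₁ := ShortComplex.mk (f (i + 1)) (g (i + 1)) (hfg _)) (S₂ := S)
      { τ₁ := 𝟙 _, τ₂ := 𝟙 _, τ₃ := f i }).1 (h (i + 1)).2.exact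
    let φ : K.sc' (i + 1 + 1) (i + 1) i ⟶ S :=
      { τ₁ := g (i + 1 + 1)
        τ₂ := 𝟙 _
        τ₃ := 𝟙 _
        comm₁₂ := ((Category.comp_id _).trans (hK (i + 1))).symm
        comm₂₃ := (Category.id_comp _).trans ((Category.comp_id _).trans (hK i)).symm }
    have : Epi φ.τ₁ := hg (i + 1 + 1)
    have : IsIso φ.τ₂ := inferInstanceAs (IsIso (𝟙 _))
    have : Mono φ.τ₃ := inferInstanceAs (Mono (𝟙 _))
    exact (ShortComplex.exact_iff_of_epi_of_isIso_of_mono φ).2 hS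
  · obtain ⟨j, hj⟩ : ∃ j, i - 1 = j := ⟨_, rfl⟩
    rw [hj]
    obtain rfl : i = j + 1 := by lia
    rw [hK, Category.assoc, ← comp_zero (f := g (j + 1 + 1)), cancel_epi] at hφ
    have := hZ j Q hQ 0
    obtain ⟨ψ, hψ⟩ := (h j).exists_extension ((h (j + 1)).2.exact.desc φ hφ)
    refine ⟨ψ, ?_⟩
    rw [hK, Category.assoc, hψ]
    exact (h (j + 1)).2.exact.g_desc φ hφ
  · have hc : (ShortComplex.mk (g (0 + 1) ≫ f 0) (g 0) (by simp [hfg])).Exact :=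
      (ShortComplex.exact_iff_of_epi_of_isIso_of_mono
        (S₁ := ShortComplex.mk (g (0 + 1) ≫ f 0) (g 0) (by simp [hfg]))
        (S₂ := ShortComplex.mk (f 0) (g 0) (hfg 0))
        { τ₁ := g (0 + 1), τ₂ := 𝟙 _, τ₃ := 𝟙 _ }).2 (h 0).2.exact
    exact hc.gIsCokernel.coconePointUniqueUpToIso (cokernelIsCokernel _) ≪≫
      cokernelIsoOfEq (hK 0).symm

/-- If a relation has predecessors and successors, every element lies on a bi-infinite chain. -/
lemma exists_int_chain {α : Type*} (R : α → α → Prop) (hl : ∀ a, ∃ b, R b a)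
    (hr : ∀ a, ∃ b, R a b) (a : α) : ∃ Z : ℤ → α, Z 0 = a ∧ ∀ i, R (Z (i + 1)) (Z i) := by
  choose l hl using hl
  choose r hr using hr
  let Z : ℤ → α := fun i => match i with
    | Int.ofNat n => l^[n] a
    | Int.negSucc n => r^[n + 1] a
  refine ⟨Z, rfl, fun i => ?_⟩
  match i with
  | Int.ofNat n =>
    change R (l^[n + 1] a) (l^[n] a)
    rw [Function.iterate_succ_apply']
    exact hl _
  | Int.negSucc 0 => exact hr a
  | Int.negSucc (n + 1) =>
    change R (r^[n + 1] a) (r^[n + 2] a)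
    rw [Function.iterate_succ_apply' r (n + 1)]
    exact hr _

lemma HasPerpCoresolution.isGorensteinProjective [EnoughProjectives C] {X : C}
    (hX : HasPerpCoresolution.{w} X) : IsGorensteinProjective X := by
  obtain ⟨Z, hZ₀, hZ⟩ := exists_int_chain
    (fun (K Y : {Y : C // HasPerpCoresolution.{w} Y}) =>
      ∃ (P : C) (f : K.1 ⟶ P) (g : P ⟶ Y.1), Projective P ∧ IsSES f g)
    (fun Y => ⟨⟨_, (isSES_kernel (Projective.π Y.1)).hasPerpCoresolution_left Y.2⟩, _, _, _,
      inferInstance, isSES_kernel (Projective.π Y.1)⟩)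
    (fun K => by
      obtain ⟨-, P, Y, f, g, hP, h, hY⟩ := isProjectivelyCoresolving_hasPerpCoresolution K.1 K.2
      exact ⟨⟨Y, hY⟩, P, f, g, hP, h⟩)
    ⟨X, hX⟩
  choose P f g hP h using hZ
  have := isGorensteinProjective_of_isSES (fun i => (Z i).1) P
    (fun i => (Z i).2.isExtPerpProjective) hP f g h
  rwa [hZ₀] at this

end TotallyAcyclic

lemma HasResDimLE.hasPerpCoresolution [HasExt.{w} C] {X : C} {n : ℕ}
    (h : HasResDimLE IsGorensteinProjective X n) (hX : IsExtPerpProjective.{w} X) :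
    HasPerpCoresolution.{w} X := by
  induction h with
  | of_mem h => exact h.hasPerpCoresolution
  | step n f g hfg hG _ ih =>
    exact hfg.hasPerpCoresolution_right
      (ih (hfg.isExtPerpProjective_left hG.hasPerpCoresolution.isExtPerpProjective hX))
      hG.hasPerpCoresolution hX

end GorensteinProjective

/-- An object of finite G-dimension is Gorenstein projective iff it lies in
`⊥pC`. -/
theorem gp_iff_perp_of_finite_gdim {C : Type u} [Category.{v} C] [Abelian C]
    [EnoughProjectives C] [HasExt.{w} C]
    (X : C) (hX : gDim X ≠ ⊤) :
    IsGorensteinProjective X ↔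
      ∀ P : C, Projective P → ∀ i : ℕ, 0 < i →
        Subsingleton (Abelian.Ext X P i) := by
  constructor
  · intro h P hP i hi
    obtain ⟨n, rfl⟩ := Nat.exists_eq_add_one_of_ne_zero hi.ne'
    exact h.hasPerpCoresolution.isExtPerpProjective P hP n
  · intro h
    obtain ⟨m, hm⟩ : ∃ m, HasResDimLE IsGorensteinProjective X m := by
      by_contra! hne
      refine hX (sInf_eq_top.2 ?_)
      rintro _ ⟨m, -, hm⟩
      exact absurd hm (hne m)
    exact (hm.hasPerpCoresolution fun P hP n => h P hP (n + 1) n.succ_pos).isGorensteinProjective
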